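/- The set α₆ = { a(1), a(2), a(31), a(32), a(333), a(331, 332) } is an optimal set of six-means for P, and the sixth quantization error is V₆(P) = 3537/563200. -/

import Mathlib

open MeasureTheory Real Set
open scoped ENNReal NNReal

/-- The three contractive similarities generating the nonhomogeneous R-triangle.
Letters 1,2,3 of the paper correspond to `0,1,2 : Fin 3`. -/
noncomputable def Smap : Fin 3 → ℝ × ℝ → ℝ × ℝ :=
  ![fun x => (x.1 / 4, x.2 / 4),
    fun x => (x.1 / 4 + 3 / 4, x.2 / 4),
    fun x => (x.1 / 2 + 1 / 4, x.2 / 2 + Real.sqrt 3 / 4)]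

/-- `Sw ω = S_{ω₁} ∘ ⋯ ∘ S_{ω_k}` for a word `ω = ω₁⋯ω_k`. -/
noncomputable def Sw (ω : List (Fin 3)) : ℝ × ℝ → ℝ × ℝ :=
  (ω.map Smap).foldr (· ∘ ·) id

/-- The probability weights `p₁ = p₂ = 1/5`, `p₃ = 3/5`. -/
noncomputable def pr : Fin 3 → ℝ := ![1/5, 1/5, 3/5]

/-- The similarity ratios `s₁ = s₂ = 1/4`, `s₃ = 1/2`. -/
noncomputable def sr : Fin 3 → ℝ := ![1/4, 1/4, 1/2]

/-- `p_ω = p_{ω₁}⋯p_{ω_k}`. -/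
noncomputable def pw (ω : List (Fin 3)) : ℝ := (ω.map pr).prod

/-- `s_ω = s_{ω₁}⋯s_{ω_k}`. -/
noncomputable def sw (ω : List (Fin 3)) : ℝ := (ω.map sr).prod

/-- `P` is the nonhomogeneous R-measure:
`P = (1/5)·P∘S₁⁻¹ + (1/5)·P∘S₂⁻¹ + (3/5)·P∘S₃⁻¹`. -/
def IsRMeasure (P : Measure (ℝ × ℝ)) : Prop :=
  P = (1/5 : ℝ≥0∞) • P.map (Smap 0) + (1/5 : ℝ≥0∞) • P.map (Smap 1)
        + (3/5 : ℝ≥0∞) • P.map (Smap 2)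

/-- The closed equilateral triangle with vertices (0,0), (1,0), (1/2, √3/2). -/
noncomputable def Δtri : Set (ℝ × ℝ) :=
  convexHull ℝ ({(0, 0), (1, 0), (1/2, Real.sqrt 3 / 2)} : Set (ℝ × ℝ))

/-- Squared Euclidean distance on ℝ². -/
def sqDist (x a : ℝ × ℝ) : ℝ := (x.1 - a.1) ^ 2 + (x.2 - a.2) ^ 2

/-- The distortion error `∫ min_{a ∈ α} ‖x − a‖² dP(x)` of a set `α` (Euclidean norm). -/
noncomputable def distortion (P : Measure (ℝ × ℝ)) (α : Set (ℝ × ℝ)) : ℝ :=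
  ∫ x, sInf ((fun a => sqDist x a) '' α) ∂P

/-- The `n`th quantization error `Vₙ(P)`. -/
noncomputable def quantErr (P : Measure (ℝ × ℝ)) (n : ℕ) : ℝ :=
  sInf { v | ∃ α : Set (ℝ × ℝ), 1 ≤ α.encard ∧ α.encard ≤ (n : ℕ∞) ∧ v = distortion P α }

/-- `α` is an optimal set of `n`-means for `P`. -/
def IsOptimalSet (P : Measure (ℝ × ℝ)) (n : ℕ) (α : Set (ℝ × ℝ)) : Prop :=
  1 ≤ α.encard ∧ α.encard ≤ (n : ℕ∞) ∧ distortion P α = quantErr P n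

/-- `a(ω) = S_ω(1/2, √3/4)`. -/
noncomputable def aw (ω : List (Fin 3)) : ℝ × ℝ := Sw ω (1/2, Real.sqrt 3 / 4)

/-- `a(ω1, ω2) = (S_{ω1}(1/2, √3/4) + S_{ω2}(1/2, √3/4))/2`. -/
noncomputable def a12 (ω : List (Fin 3)) : ℝ × ℝ :=
  (1/2 : ℝ) • (aw (ω ++ [0]) + aw (ω ++ [1]))

/-- A weighted point `(x, √3 y) / 64` of mass `w / 2500`, with dual price `u / 4096`. -/
structure PricedPoint where
  w : ℤ
  u : ℤ
  x : ℤ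
  y : ℤ

namespace PricedPoint

/-- The squared Euclidean distance of two priced points, in units of `1 / 4096`. -/
def dist2 (s t : PricedPoint) : ℤ := (s.x - t.x) * (s.x - t.x) + 3 * ((s.y - t.y) * (s.y - t.y))

/-- The surplus `w (u - ‖v - a‖²)` of a priced point `v` with respect to the centre
`a = (p, √3 q) / 64`. -/
def surplus (s : PricedPoint) (p q : ℝ) : ℝ :=
  s.w * (s.u - ((s.x - p) ^ 2 + 3 * (s.y - q) ^ 2))

/-- Branch and bound over the subsets of `l`, verifying that no centre collects a total surplus
larger than `c`. The accumulators `W`, `X`, `Y`, `A` are the coefficients of the total surplus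
`A - W (p² + 3 q²) + 2 (X p + 3 Y q)` of the points chosen so far. -/
def surplusBound (c : ℤ) : ℕ → List PricedPoint → ℤ → ℤ → ℤ → ℤ → Bool
  | 0, _, _, _, _, _ => false
  | n + 1, l, W, X, Y, A =>
    let r := c - A - (l.map fun s => s.w * s.u).sum
    (decide (0 < W ∧ X * X + 3 * (Y * Y) ≤ r * W)
        || decide (W = 0 ∧ X = 0 ∧ Y = 0 ∧ 0 ≤ r)) ||
      match l with
      | [] => false
      | s :: t =>
        surplusBound c n t W X Y A &&
          surplusBound c n (t.filter fun v => decide (s.dist2 v < 2 * (s.u + v.u)))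
            (W + s.w) (X + s.w * s.x) (Y + s.w * s.y)
            (A + s.w * (s.u - (s.x * s.x + 3 * (s.y * s.y))))

lemma surplus_le (s : PricedPoint) (hs : 0 ≤ s.w) (p q : ℝ) :
    max 0 (s.surplus p q) ≤ s.w * max 0 (s.u : ℝ) := by
  have hw : (0 : ℝ) ≤ s.w := by exact_mod_cast hs
  refine max_le (by positivity) (mul_le_mul_of_nonneg_left ?_ hw)
  nlinarith [le_max_right 0 (s.u : ℝ), sq_nonneg ((s.x : ℝ) - p), sq_nonneg ((s.y : ℝ) - q)]

/-- A centre cannot collect positive surplus from two points that are far apart. -/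
lemma surplus_nonpos_of_far {s v : PricedPoint} (hs : 0 ≤ s.w) (hv : 0 ≤ v.w)
    (h : 2 * (s.u + v.u) ≤ s.dist2 v) {p q : ℝ} (hpos : 0 < s.surplus p q) :
    v.surplus p q ≤ 0 := by
  have hs' : (0 : ℝ) ≤ s.w := by exact_mod_cast hs
  have hv' : (0 : ℝ) ≤ v.w := by exact_mod_cast hv
  have h' : 2 * ((s.u : ℝ) + v.u) ≤
      (s.x - v.x) * (s.x - v.x) + 3 * ((s.y - v.y) * (s.y - v.y)) := by
    have := h
    unfold dist2 at this
    exact_mod_cast this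
  have h1 : (0 : ℝ) < s.u - ((s.x - p) ^ 2 + 3 * (s.y - q) ^ 2) := by
    by_contra hn
    exact absurd (mul_nonpos_of_nonneg_of_nonpos hs' (not_lt.mp hn)) (not_le.mpr hpos)
  refine mul_nonpos_of_nonneg_of_nonpos hv' ?_
  nlinarith [sq_nonneg ((s.x : ℝ) - p + (v.x - p)), sq_nonneg ((s.y : ℝ) - q + (v.y - q))]

lemma sum_surplus_le_sum_filter (l : List PricedPoint) (f : PricedPoint → Bool) (p q : ℝ)
    (h : ∀ v ∈ l, f v = false → v.surplus p q ≤ 0) :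
    (l.map fun v => max 0 (v.surplus p q)).sum ≤
      ((l.filter f).map fun v => max 0 (v.surplus p q)).sum := by
  induction l with
  | nil => simp
  | cons v t ih =>
    have iht := ih fun v hv => h v (List.mem_cons_of_mem _ hv)
    cases hfv : f v with
    | false =>
      have := h v List.mem_cons_self hfv
      simp [hfv, max_eq_left this, iht]
    | true => simpa [hfv] using iht

lemma sum_surplus_le_sum_price (l : List PricedPoint) (hl : ∀ s ∈ l, 0 ≤ s.w ∧ 0 ≤ s.u)
    (p q : ℝ) :
    (l.map fun v => max 0 (v.surplus p q)).sum ≤ ((l.map fun s => s.w * s.u).sum : ℤ) := by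
  induction l with
  | nil => simp
  | cons s t ih =>
    obtain ⟨hw, hu⟩ := hl s List.mem_cons_self
    have hs := s.surplus_le hw p q
    have hu' : (0 : ℝ) ≤ s.u := by exact_mod_cast hu
    rw [max_eq_right hu'] at hs
    have := ih fun v hv => hl v (List.mem_cons_of_mem _ hv)
    simp only [List.map_cons, List.sum_cons, Int.cast_add, Int.cast_mul]
    linarith

theorem surplus_le_of_surplusBound (c : ℤ) (p q : ℝ) (n : ℕ) (l : List PricedPoint)
    (hl : ∀ s ∈ l, 0 ≤ s.w ∧ 0 ≤ s.u) (W X Y A : ℤ) (h : surplusBound c n l W X Y A = true) :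
    A - W * (p ^ 2 + 3 * q ^ 2) + 2 * (X * p + 3 * (Y * q)) +
      (l.map fun v => max 0 (v.surplus p q)).sum ≤ c := by
  induction n generalizing l W X Y A with
  | zero => simp [surplusBound] at h
  | succ n ih =>
    have hsum := sum_surplus_le_sum_price l hl p q
    unfold surplusBound at h
    rw [Bool.or_eq_true, Bool.or_eq_true, decide_eq_true_iff, decide_eq_true_iff] at h
    set R : ℤ := (l.map fun s => s.w * s.u).sum
    rcases h with (⟨hW, hr⟩ | ⟨rfl, rfl, rfl, hr⟩) | h
    · have hW' : (0 : ℝ) < W := by exact_mod_cast hW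
      have hr' : (X * X + 3 * (Y * Y) : ℝ) ≤ (c - A - R) * W := by exact_mod_cast hr
      have : (A - W * (p ^ 2 + 3 * q ^ 2) + 2 * (X * p + 3 * (Y * q)) + R - c : ℝ) * W ≤ 0 := by
        nlinarith [sq_nonneg (W * p - X : ℝ), sq_nonneg (W * q - Y : ℝ)]
      nlinarith [nonpos_of_mul_nonpos_left this hW']
    · have hr' : (0 : ℝ) ≤ c - A - R := by exact_mod_cast hr
      simp only [Int.cast_zero]
      linarith
    · match l, h with
      | s :: t, h =>
        obtain ⟨hskip, htake⟩ := Bool.and_eq_true_iff.mp h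
        have ht : ∀ v ∈ t, 0 ≤ v.w ∧ 0 ≤ v.u := fun v hv => hl v (List.mem_cons_of_mem _ hv)
        rw [List.map_cons, List.sum_cons]
        rcases le_or_gt (s.surplus p q) 0 with hle | hpos
        · rw [max_eq_left hle, zero_add]
          exact ih t ht W X Y A hskip
        · have key := ih _ (fun v hv => ht v (List.mem_of_mem_filter hv)) _ _ _ _ htake
          have hfil := sum_surplus_le_sum_filter t
            (fun v => decide (s.dist2 v < 2 * (s.u + v.u))) p q fun v hv hfv =>
              surplus_nonpos_of_far (hl s List.mem_cons_self).1 (ht v hv).1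
                (not_lt.mp (of_decide_eq_false hfv)) hpos
          rw [max_eq_right hpos.le]
          push_cast at key
          unfold surplus at hfil key ⊢
          nlinarith

end PricedPoint

/-- The vertices of the thirteen cells `11, 12, 13, 21, 22, 23, 31, 32, 331, 332, 3331, 3332, 3333`,
with prices certifying the optimality of the six-means. -/
def pricedVertices : List PricedPoint :=
  [⟨150, 69, 8, 8⟩, ⟨150, 69, 56, 8⟩, ⟨150, 62, 20, 20⟩, ⟨150, 62, 44, 20⟩,
    ⟨162, 46, 32, 32⟩, ⟨75, 90, 16, 16⟩, ⟨75, 90, 48, 16⟩, ⟨90, 71, 26, 26⟩,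
    ⟨90, 71, 38, 26⟩, ⟨45, 107, 24, 24⟩, ⟨45, 107, 40, 24⟩, ⟨75, 61, 4, 4⟩,
    ⟨75, 61, 12, 4⟩, ⟨75, 61, 52, 4⟩, ⟨75, 61, 60, 4⟩, ⟨81, 45, 30, 30⟩,
    ⟨81, 45, 34, 30⟩, ⟨50, 72, 2, 2⟩, ⟨50, 72, 14, 2⟩, ⟨50, 72, 50, 2⟩,
    ⟨50, 72, 62, 2⟩, ⟨75, 46, 24, 16⟩, ⟨75, 46, 40, 16⟩, ⟨25, 118, 0, 0⟩,
    ⟨25, 118, 16, 0⟩, ⟨25, 118, 48, 0⟩, ⟨25, 118, 64, 0⟩, ⟨45, 65, 28, 24⟩,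
    ⟨45, 65, 36, 24⟩, ⟨25, 82, 4, 0⟩, ⟨25, 82, 12, 0⟩, ⟨25, 82, 52, 0⟩,
    ⟨25, 82, 60, 0⟩, ⟨27, 35, 28, 28⟩, ⟨27, 35, 36, 28⟩, ⟨54, 16, 29, 29⟩,
    ⟨54, 16, 35, 29⟩, ⟨27, 26, 30, 28⟩, ⟨27, 26, 34, 28⟩]

lemma pricedVertices_nonneg : ∀ s ∈ pricedVertices, 0 ≤ s.w ∧ 0 ≤ s.u := by
  simp [pricedVertices]

lemma surplusBound_pricedVertices :
    PricedPoint.surplusBound 13500 40 pricedVertices 0 0 0 0 = true := by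
  decide +kernel

lemma continuous_Smap (i : Fin 3) : Continuous (Smap i) := by
  fin_cases i <;> simp [Smap] <;> constructor <;> fun_prop

lemma IsRMeasure.measure_eq {P : Measure (ℝ × ℝ)} (hP : IsRMeasure P) {s : Set (ℝ × ℝ)}
    (hs : MeasurableSet s) :
    P s = (1/5 : ℝ≥0∞) * P (Smap 0 ⁻¹' s) + (1/5 : ℝ≥0∞) * P (Smap 1 ⁻¹' s)
      + (3/5 : ℝ≥0∞) * P (Smap 2 ⁻¹' s) := by
  have h := congrArg (fun μ => μ s) hP
  simp only [Measure.add_apply, Measure.smul_apply, smul_eq_mul,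
    Measure.map_apply (continuous_Smap _).measurable hs] at h
  exact h

section RMeasure

variable {P : Measure (ℝ × ℝ)} [IsProbabilityMeasure P]

lemma weights_sum : (1/5 : ℝ≥0∞) + 1/5 + 3/5 = 1 := by
  rw [← ENNReal.add_div, ← ENNReal.add_div]
  norm_num
  exact ENNReal.div_self (by norm_num) (by norm_num)

/-- A function which every map of the system contracts towards nonnegative values is
almost surely nonnegative. -/
lemma IsRMeasure.ae_nonneg (hP : IsRMeasure P) {β : ℝ × ℝ → ℝ} (hβ : Measurable β)
    (h : ∀ i x, β (Smap i x) < 0 → β x ≤ 2 * β (Smap i x)) : ∀ᵐ x ∂P, 0 ≤ β x := by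
  have hmeas (t : ℝ) : MeasurableSet {x | β x < t} := measurableSet_lt hβ measurable_const
  have step (t : ℝ) (ht : 0 < t) : P {x | β x < -t} ≤ P {x | β x < -(2 * t)} := by
    have hi (i : Fin 3) : Smap i ⁻¹' {x | β x < -t} ⊆ {x | β x < -(2 * t)} := fun x hx => by
      have hx' : β (Smap i x) < -t := hx
      show β x < -(2 * t)
      linarith [h i x (by linarith)]
    calc P {x | β x < -t} ≤ (1/5 : ℝ≥0∞) * P {x | β x < -(2 * t)}
          + (1/5 : ℝ≥0∞) * P {x | β x < -(2 * t)} + (3/5 : ℝ≥0∞) * P {x | β x < -(2 * t)} := by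
          rw [hP.measure_eq (hmeas (-t))]
          gcongr <;> exact hi _
      _ = P {x | β x < -(2 * t)} := by rw [← add_mul, ← add_mul, weights_sum, one_mul]
  have iter (t : ℝ) (ht : 0 < t) (n : ℕ) : P {x | β x < -t} ≤ P {x | β x < -(2 ^ n * t)} := by
    induction n with
    | zero => simp
    | succ n ih =>
      refine ih.trans ((step _ (by positivity)).trans_eq ?_)
      rw [pow_succ']
      ring_nf
  have lim (t : ℝ) (ht : 0 < t) : P {x | β x < -t} = 0 := by
    have hanti : Antitone fun n : ℕ => {x | β x < -(2 ^ n * t)} := fun m n hmn x hx => by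
      have hpow : (2 : ℝ) ^ m ≤ 2 ^ n := pow_le_pow_right₀ (by norm_num) hmn
      have hx' : β x < -(2 ^ n * t) := hx
      show β x < -(2 ^ m * t)
      nlinarith
    have hempty : ⋂ n : ℕ, {x | β x < -(2 ^ n * t)} = ∅ := by
      refine eq_empty_of_forall_notMem fun x hx => ?_
      obtain ⟨n, hn⟩ := pow_unbounded_of_one_lt (-β x / t) (one_lt_two : (1 : ℝ) < 2)
      have hx' : β x < -(2 ^ n * t) := mem_iInter.mp hx n
      rw [div_lt_iff₀ ht] at hn
      linarith
    have htend := tendsto_measure_iInter_atTop (μ := P)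
      (fun n => (hmeas (-(2 ^ n * t))).nullMeasurableSet) hanti ⟨0, measure_ne_top _ _⟩
    rw [hempty, measure_empty] at htend
    exact le_antisymm (ge_of_tendsto' htend (iter t ht)) zero_le
  have hall : ∀ᵐ x ∂P, ∀ n : ℕ, -(1 / ((n : ℝ) + 1)) ≤ β x := by
    refine ae_all_iff.mpr fun n => ?_
    rw [ae_iff]
    simp only [not_le]
    exact lim _ (by positivity)
  filter_upwards [hall] with x hx
  by_contra hneg
  obtain ⟨n, hn⟩ := exists_nat_one_div_lt (neg_pos.mpr (not_le.mp hneg))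
  linarith [hx n]

/-- `P` is carried by the equilateral triangle, described by barycentric coordinates. -/
lemma IsRMeasure.ae_triangle (hP : IsRMeasure P) :
    ∀ᵐ x ∂P, 0 ≤ x.2 * √3 ∧ x.2 * √3 ≤ 3 * x.1 ∧ x.2 * √3 ≤ 3 * (1 - x.1) := by
  have h3 : √3 * √3 = 3 := Real.mul_self_sqrt (by norm_num)
  have h1 := hP.ae_nonneg (β := fun x => x.2 * √3) (by fun_prop) fun i x hx => by
    fin_cases i <;> simp [Smap] at hx ⊢ <;> nlinarith
  have h2 := hP.ae_nonneg (β := fun x => 3 * x.1 - x.2 * √3) (by fun_prop) fun i x hx => by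
    fin_cases i <;> simp [Smap] at hx ⊢ <;> nlinarith
  have h3 := hP.ae_nonneg (β := fun x => 3 * (1 - x.1) - x.2 * √3) (by fun_prop) fun i x hx => by
    fin_cases i <;> simp [Smap] at hx ⊢ <;> nlinarith
  filter_upwards [h1, h2, h3] with x hx1 hx2 hx3
  exact ⟨hx1, by linarith, by linarith⟩

lemma IsRMeasure.integrable (hP : IsRMeasure P) {f : ℝ × ℝ → ℝ} (hf : Continuous f) :
    Integrable f P := by
  obtain ⟨C, hC⟩ := (isCompact_Icc (a := ((0, 0) : ℝ × ℝ)) (b := (1, 1))).exists_bound_of_continuousOn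
    hf.continuousOn
  refine Integrable.of_bound hf.aestronglyMeasurable C ?_
  filter_upwards [hP.ae_triangle] with x hx
  have h3 : √3 * √3 = 3 := Real.mul_self_sqrt (by norm_num)
  have h3' : (3 / 2 : ℝ) ≤ √3 := Real.le_sqrt_of_sq_le (by norm_num)
  obtain ⟨h1, h2, h3⟩ := hx
  refine hC x ⟨⟨?_, ?_⟩, ⟨?_, ?_⟩⟩ <;> simp only <;> nlinarith

lemma IsRMeasure.integral_eq (hP : IsRMeasure P) {f : ℝ × ℝ → ℝ} (hf : Continuous f) :
    ∫ x, f x ∂P = 1/5 * ∫ x, f (Smap 0 x) ∂P + 1/5 * ∫ x, f (Smap 1 x) ∂P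
      + 3/5 * ∫ x, f (Smap 2 x) ∂P := by
  have hS (i : Fin 3) : AEMeasurable (Smap i) P := (continuous_Smap i).aemeasurable
  have hmap (i : Fin 3) : ∫ x, f x ∂(P.map (Smap i)) = ∫ x, f (Smap i x) ∂P :=
    integral_map (hS i) hf.aestronglyMeasurable
  have hint (i : Fin 3) (c : ℝ≥0∞) (hc : c ≠ ∞) : Integrable f (c • P.map (Smap i)) :=
    ((integrable_map_measure hf.aestronglyMeasurable (hS i)).mpr
      (hP.integrable (hf.comp (continuous_Smap i)))).smul_measure hc
  have h15 : (1/5 : ℝ≥0∞) ≠ ∞ := by simp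
  have h35 : (3/5 : ℝ≥0∞) ≠ ∞ := ENNReal.div_ne_top (by norm_num) (by norm_num)
  have h := congrArg (fun μ => ∫ x, f x ∂μ) hP
  beta_reduce at h
  rw [integral_add_measure ((hint 0 _ h15).add_measure (hint 1 _ h15)) (hint 2 _ h35),
    integral_add_measure (hint 0 _ h15) (hint 1 _ h15)] at h
  simp only [integral_smul_measure, hmap, smul_eq_mul] at h
  simpa [ENNReal.toReal_div] using h

lemma IsRMeasure.integral_quadratic (hP : IsRMeasure P) (A B C D : ℝ) :
    ∫ x : ℝ × ℝ, (A * (x.1 ^ 2 + x.2 ^ 2) + B * x.1 + C * x.2 + D) ∂P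
      = A * (13/22) + B * (1/2) + C * (√3 / 4) + D := by
  have h3 : √3 * √3 = 3 := Real.mul_self_sqrt (by norm_num)
  have expand (A B C D : ℝ) :
      ∫ x : ℝ × ℝ, (A * (x.1 ^ 2 + x.2 ^ 2) + B * x.1 + C * x.2 + D) ∂P
        = A * ∫ x : ℝ × ℝ, (x.1 ^ 2 + x.2 ^ 2) ∂P + B * ∫ x : ℝ × ℝ, x.1 ∂P
          + C * ∫ x : ℝ × ℝ, x.2 ∂P + D := by
    rw [integral_add (hP.integrable (by fun_prop)) (hP.integrable (by fun_prop)),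
      integral_add (hP.integrable (by fun_prop)) (hP.integrable (by fun_prop)),
      integral_add (hP.integrable (by fun_prop)) (hP.integrable (by fun_prop)),
      integral_const_mul, integral_const_mul, integral_const_mul]
    simp
  have self (A B C D : ℝ) := hP.integral_eq
    (f := fun x => A * (x.1 ^ 2 + x.2 ^ 2) + B * x.1 + C * x.2 + D) (by fun_prop)
  have pull0 (A B C D : ℝ) : ∀ x, A * ((Smap 0 x).1 ^ 2 + (Smap 0 x).2 ^ 2) + B * (Smap 0 x).1
      + C * (Smap 0 x).2 + D
      = A / 16 * (x.1 ^ 2 + x.2 ^ 2) + B / 4 * x.1 + C / 4 * x.2 + D := fun x => by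
    simp [Smap]; ring
  have pull1 (A B C D : ℝ) : ∀ x, A * ((Smap 1 x).1 ^ 2 + (Smap 1 x).2 ^ 2) + B * (Smap 1 x).1
      + C * (Smap 1 x).2 + D
      = A / 16 * (x.1 ^ 2 + x.2 ^ 2) + (A * 3 / 8 + B / 4) * x.1 + C / 4 * x.2
        + (A * 9 / 16 + B * 3 / 4 + D) := fun x => by
    simp [Smap]; ring
  have pull2 (A B C D : ℝ) : ∀ x, A * ((Smap 2 x).1 ^ 2 + (Smap 2 x).2 ^ 2) + B * (Smap 2 x).1
      + C * (Smap 2 x).2 + D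
      = A / 4 * (x.1 ^ 2 + x.2 ^ 2) + (A / 4 + B / 2) * x.1 + (A * √3 / 4 + C / 2) * x.2
        + (A / 4 + B / 4 + C * √3 / 4 + D) := fun x => by
    simp only [Smap]
    simp
    linear_combination A / 16 * h3
  simp only [pull0, pull1, pull2, expand] at self
  have hx := self 0 1 0 0
  have hy := self 0 0 1 0
  have hxy := self 1 0 0 0
  have hx' : ∫ x : ℝ × ℝ, x.1 ∂P = 1/2 := by linarith
  have hy' : ∫ x : ℝ × ℝ, x.2 ∂P = √3 / 4 := by linarith
  rw [hx', hy'] at hxy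
  have hxy' : ∫ x : ℝ × ℝ, (x.1 ^ 2 + x.2 ^ 2) ∂P = 13/22 := by nlinarith
  rw [expand, hx', hy', hxy']

/-- The integral of `f` over the copy of `P` on the triangle of side `r` whose lower left vertex is
`(c, √3 d)`. -/
noncomputable def cellIntegral (P : Measure (ℝ × ℝ)) (f : ℝ × ℝ → ℝ) (r c d : ℝ) : ℝ :=
  ∫ x, f (r * x.1 + c, r * x.2 + √3 * d) ∂P

lemma cellIntegral_unit (P : Measure (ℝ × ℝ)) (f : ℝ × ℝ → ℝ) :
    cellIntegral P f 1 0 0 = ∫ x, f x ∂P := by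
  simp [cellIntegral]

lemma IsRMeasure.cellIntegral_eq (hP : IsRMeasure P) {f : ℝ × ℝ → ℝ} (hf : Continuous f)
    (r c d : ℝ) :
    cellIntegral P f r c d = 1/5 * cellIntegral P f (r / 4) c d
      + 1/5 * cellIntegral P f (r / 4) (c + 3 * r / 4) d
      + 3/5 * cellIntegral P f (r / 2) (c + r / 4) (d + r / 4) := by
  rw [cellIntegral, hP.integral_eq (f := fun x => f (r * x.1 + c, r * x.2 + √3 * d)) (by fun_prop)]
  simp only [cellIntegral, Smap]
  congr! 6 <;> simp <;> ring_nf <;> trivial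

lemma IsRMeasure.cellIntegral_sqDist (hP : IsRMeasure P) (r c d p q : ℝ) :
    cellIntegral P (fun x => sqDist x (p, √3 * q)) r c d
      = r ^ 2 * (27/176) + (c + r / 2 - p) ^ 2 + 3 * (d + r / 4 - q) ^ 2 := by
  have h3 : √3 * √3 = 3 := Real.mul_self_sqrt (by norm_num)
  have h (x : ℝ × ℝ) : sqDist (r * x.1 + c, r * x.2 + √3 * d) (p, √3 * q)
      = r ^ 2 * (x.1 ^ 2 + x.2 ^ 2) + 2 * r * (c - p) * x.1 + 2 * r * √3 * (d - q) * x.2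
        + ((c - p) ^ 2 + 3 * (d - q) ^ 2) := by
    simp only [sqDist]
    linear_combination (d - q) ^ 2 * h3
  simp only [cellIntegral, h]
  rw [hP.integral_quadratic]
  linear_combination r * (d - q) / 2 * h3

/-- The squared distance to the set `α`. -/
noncomputable def minSqDist (α : Set (ℝ × ℝ)) (x : ℝ × ℝ) : ℝ :=
  sInf ((fun a => sqDist x a) '' α)

lemma minSqDist_le {α : Set (ℝ × ℝ)} {a : ℝ × ℝ} (ha : a ∈ α) (x : ℝ × ℝ) :
    minSqDist α x ≤ sqDist x a :=
  csInf_le ⟨0, by rintro _ ⟨b, -, rfl⟩; unfold sqDist; positivity⟩ (mem_image_of_mem _ ha)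

lemma exists_minSqDist_eq {α : Set (ℝ × ℝ)} (hf : α.Finite) (hne : α.Nonempty) (x : ℝ × ℝ) :
    ∃ a ∈ α, sqDist x a = minSqDist α x :=
  (hne.image _).csInf_mem (hf.image _)

lemma continuous_minSqDist {α : Set (ℝ × ℝ)} (hf : α.Finite) (hne : α.Nonempty) :
    Continuous (minSqDist α) := by
  have hne' : hf.toFinset.Nonempty := by simpa using hne
  have : minSqDist α = fun x => hf.toFinset.inf' hne' fun a => sqDist x a := by
    funext x
    rw [Finset.inf'_eq_csInf_image, Finite.coe_toFinset, minSqDist]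
  rw [this]
  refine Continuous.finset_inf'_apply _ fun a _ => ?_
  unfold sqDist
  fun_prop

/-- Since `‖x‖² - minSqDist α x` is convex, moving the mass of a cell to the vertices of its
triangle can only increase its mean. -/
lemma IsRMeasure.le_cellIntegral (hP : IsRMeasure P) {α : Set (ℝ × ℝ)} (hf : α.Finite)
    (hne : α.Nonempty) (r c d : ℝ) :
    1/4 * minSqDist α (c, √3 * d) + 1/4 * minSqDist α (c + r, √3 * d)
      + 1/2 * minSqDist α (c + r / 2, √3 * (d + r / 2)) - 7/44 * r ^ 2
      ≤ cellIntegral P (minSqDist α) r c d := by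
  have h3 : √3 * √3 = 3 := Real.mul_self_sqrt (by norm_num)
  have hcont := continuous_minSqDist hf hne
  set m₁ := minSqDist α (c, √3 * d)
  set m₂ := minSqDist α (c + r, √3 * d)
  set m₃ := minSqDist α (c + r / 2, √3 * (d + r / 2))
  have hquad := hP.integral_quadratic (r ^ 2) (m₂ - m₁ - r ^ 2)
    (√3 / 3 * (2 * m₃ - m₁ - m₂ - r ^ 2)) m₁
  have hle : ∫ x : ℝ × ℝ, (r ^ 2 * (x.1 ^ 2 + x.2 ^ 2) + (m₂ - m₁ - r ^ 2) * x.1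
      + √3 / 3 * (2 * m₃ - m₁ - m₂ - r ^ 2) * x.2 + m₁) ∂P
      ≤ cellIntegral P (minSqDist α) r c d := by
    refine integral_mono_ae (hP.integrable (by fun_prop)) (hP.integrable (by fun_prop)) ?_
    filter_upwards [hP.ae_triangle] with x ⟨hx1, hx2, hx3⟩
    obtain ⟨a, ha, hmin⟩ := exists_minSqDist_eq hf hne (r * x.1 + c, r * x.2 + √3 * d)
    have e₁ := mul_le_mul_of_nonneg_left (minSqDist_le ha (c, √3 * d))
      (by linarith : 0 ≤ (3 * (1 - x.1) - x.2 * √3) / 3)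
    have e₂ := mul_le_mul_of_nonneg_left (minSqDist_le ha (c + r, √3 * d))
      (by linarith : 0 ≤ (3 * x.1 - x.2 * √3) / 3)
    have e₃ := mul_le_mul_of_nonneg_left (minSqDist_le ha (c + r / 2, √3 * (d + r / 2)))
      (by linarith : 0 ≤ 2 * (x.2 * √3) / 3)
    rw [← hmin]
    simp only [sqDist] at e₁ e₂ e₃ ⊢
    have key : (3 * (1 - x.1) - x.2 * √3) / 3 * ((c - a.1) ^ 2 + (√3 * d - a.2) ^ 2)
        + (3 * x.1 - x.2 * √3) / 3 * ((c + r - a.1) ^ 2 + (√3 * d - a.2) ^ 2)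
        + 2 * (x.2 * √3) / 3 * ((c + r / 2 - a.1) ^ 2 + (√3 * (d + r / 2) - a.2) ^ 2)
        = (r * x.1 + c - a.1) ^ 2 + (r * x.2 + √3 * d - a.2) ^ 2
          + r ^ 2 * (x.1 + √3 / 3 * x.2 - (x.1 ^ 2 + x.2 ^ 2)) := by
      linear_combination (x.2 * √3 * r ^ 2 / 6 + 2 * x.2 * √3 * r * d / 3 - 2 * x.2 * r * a.2 / 3) * h3
    linarith
  refine le_trans (le_of_eq ?_) (hquad.symm.trans_le hle)
  linear_combination (-(2 * m₃ - m₁ - m₂ - r ^ 2) / 12) * h3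

end RMeasure

/-- A finite set of at most `n` centres saves at most `n * c` against the prices. -/
lemma sum_price_le_sum_minSqDist {l : List PricedPoint} (hl : ∀ s ∈ l, 0 ≤ s.w) {c : ℝ} {n : ℕ}
    (hc : ∀ p q : ℝ, (l.map fun v => max 0 (v.surplus p q)).sum ≤ c) (hc0 : 0 ≤ c)
    {α : Set (ℝ × ℝ)} (hf : α.Finite) (hne : α.Nonempty) (hcard : hf.toFinset.card ≤ n) :
    (l.map fun v => (v.w * v.u : ℝ)).sum ≤
      (l.map fun v => v.w * (4096 * minSqDist α (v.x / 64, √3 * (v.y / 64)))).sum + n * c := by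
  have h3 : √3 * √3 = 3 := Real.mul_self_sqrt (by norm_num)
  have hpoint (v : PricedPoint) (a : ℝ × ℝ) :
      v.surplus (64 * a.1) (64 * (a.2 * √3 / 3))
        = v.w * (v.u - 4096 * sqDist (v.x / 64, √3 * (v.y / 64)) a) := by
    simp only [PricedPoint.surplus, sqDist]
    linear_combination v.w * (v.y ^ 2 - 4096 * a.2 ^ 2 / 3) * h3
  have hsum : (l.map fun v => (v.w * v.u : ℝ)).sum ≤
      (l.map fun v => v.w * (4096 * minSqDist α (v.x / 64, √3 * (v.y / 64)))).sum
        + ∑ a ∈ hf.toFinset,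
          (l.map fun v => max 0 (v.surplus (64 * a.1) (64 * (a.2 * √3 / 3)))).sum := by
    clear hc
    induction l with
    | nil => simp
    | cons v t ih =>
      have iht := ih fun s hs => hl s (List.mem_cons_of_mem _ hs)
      obtain ⟨a, ha, hmin⟩ := exists_minSqDist_eq hf hne (v.x / 64, √3 * (v.y / 64))
      have hv : v.surplus (64 * a.1) (64 * (a.2 * √3 / 3)) ≤
          ∑ a ∈ hf.toFinset, max 0 (v.surplus (64 * a.1) (64 * (a.2 * √3 / 3))) :=
        (le_max_right _ _).trans (Finset.single_le_sum
          (f := fun a : ℝ × ℝ => max 0 (v.surplus (64 * a.1) (64 * (a.2 * √3 / 3))))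
          (fun _ _ => le_max_left _ _) (hf.mem_toFinset.mpr ha))
      rw [hpoint, hmin] at hv
      simp only [List.map_cons, List.sum_cons, Finset.sum_add_distrib]
      linarith
  have hbound := Finset.sum_le_card_nsmul hf.toFinset _ c fun a _ =>
    hc (64 * a.1) (64 * (a.2 * √3 / 3))
  rw [nsmul_eq_mul] at hbound
  have hn : (hf.toFinset.card : ℝ) * c ≤ n * c :=
    mul_le_mul_of_nonneg_right (by exact_mod_cast hcard) hc0
  linarith

section SixMeans

variable {P : Measure (ℝ × ℝ)} [IsProbabilityMeasure P]

lemma IsRMeasure.cellIntegral_le (hP : IsRMeasure P) {α : Set (ℝ × ℝ)} (hf : α.Finite)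
    {p q : ℝ} (hpq : (p, √3 * q) ∈ α) (r c d : ℝ) :
    cellIntegral P (minSqDist α) r c d
      ≤ r ^ 2 * (27/176) + (c + r / 2 - p) ^ 2 + 3 * (d + r / 4 - q) ^ 2 := by
  have hcont := continuous_minSqDist hf ⟨_, hpq⟩
  rw [← hP.cellIntegral_sqDist]
  refine integral_mono (hP.integrable (by fun_prop)) (hP.integrable ?_) fun x => minSqDist_le hpq _
  unfold sqDist
  fun_prop

lemma IsRMeasure.le_distortion_of_card_le_six (hP : IsRMeasure P) {α : Set (ℝ × ℝ)}
    (hne : α.Nonempty) (hcard : α.encard ≤ (6 : ℕ)) : 3537/563200 ≤ distortion P α := by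
  have hf : α.Finite := finite_of_encard_le_coe hcard
  have hcont := continuous_minSqDist hf hne
  have hcard' : hf.toFinset.card ≤ 6 := by
    rw [hf.encard_eq_coe_toFinset_card] at hcard
    exact_mod_cast hcard
  have hdual := sum_price_le_sum_minSqDist (l := pricedVertices) (c := 13500)
    (fun s hs => (pricedVertices_nonneg s hs).1)
    (fun p q => by
      simpa using PricedPoint.surplus_le_of_surplusBound 13500 p q 40 pricedVertices
        pricedVertices_nonneg 0 0 0 0 surplusBound_pricedVertices)
    (by norm_num) hf hne hcard'
  have hD : distortion P α = cellIntegral P (minSqDist α) 1 0 0 := (cellIntegral_unit P _).symm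
  have split := hP.cellIntegral_eq hcont
  have leaf := hP.le_cellIntegral hf hne
  have s0 := split 1 0 0
  have s1 := split (1/4) 0 0
  have s2 := split (1/4) (3/4) 0
  have s3 := split (1/2) (1/4) (1/4)
  have s33 := split (1/4) (3/8) (3/8)
  have s333 := split (1/8) (7/16) (7/16)
  have l11 := leaf (1/16) 0 0
  have l12 := leaf (1/16) (3/16) 0
  have l13 := leaf (1/8) (1/16) (1/16)
  have l21 := leaf (1/16) (3/4) 0
  have l22 := leaf (1/16) (15/16) 0
  have l23 := leaf (1/8) (13/16) (1/16)
  have l31 := leaf (1/8) (1/4) (1/4)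
  have l32 := leaf (1/8) (5/8) (1/4)
  have l331 := leaf (1/16) (3/8) (3/8)
  have l332 := leaf (1/16) (9/16) (3/8)
  have l3331 := leaf (1/32) (7/16) (7/16)
  have l3332 := leaf (1/32) (17/32) (7/16)
  have l3333 := leaf (1/16) (15/32) (15/32)
  simp only [pricedVertices, List.map_cons, List.map_nil, List.sum_cons, List.sum_nil] at hdual
  norm_num at hdual s0 s1 s2 s3 s33 s333 l11 l12 l13 l21 l22 l23 l31 l32 l331 l332 l3331 l3332 l3333
  rw [hD]
  linarith

lemma IsRMeasure.distortion_le_of_six_means (hP : IsRMeasure P) {α : Set (ℝ × ℝ)} (hf : α.Finite)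
    (h1 : (1/8, √3 * (1/16)) ∈ α) (h2 : (7/8, √3 * (1/16)) ∈ α)
    (h31 : (5/16, √3 * (9/32)) ∈ α) (h32 : (11/16, √3 * (9/32)) ∈ α)
    (h333 : (1/2, √3 * (15/32)) ∈ α) (h3312 : (1/2, √3 * (25/64)) ∈ α) :
    distortion P α ≤ 3537/563200 := by
  have hcont := continuous_minSqDist hf ⟨_, h1⟩
  have hD : distortion P α = cellIntegral P (minSqDist α) 1 0 0 := (cellIntegral_unit P _).symm
  have split := hP.cellIntegral_eq hcont
  have s0 := split 1 0 0
  have s3 := split (1/2) (1/4) (1/4)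
  have s33 := split (1/4) (3/8) (3/8)
  have l1 := hP.cellIntegral_le hf h1 (1/4) 0 0
  have l2 := hP.cellIntegral_le hf h2 (1/4) (3/4) 0
  have l31 := hP.cellIntegral_le hf h31 (1/8) (1/4) (1/4)
  have l32 := hP.cellIntegral_le hf h32 (1/8) (5/8) (1/4)
  have l331 := hP.cellIntegral_le hf h3312 (1/16) (3/8) (3/8)
  have l332 := hP.cellIntegral_le hf h3312 (1/16) (9/16) (3/8)
  have l333 := hP.cellIntegral_le hf h333 (1/8) (7/16) (7/16)
  norm_num at s0 s3 s33 l1 l2 l31 l32 l331 l332 l333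
  rw [hD]
  linarith

end SixMeans

lemma six_means_eq :
    ({aw [0], aw [1], aw [2, 0], aw [2, 1], aw [2, 2, 2], a12 [2, 2]} : Set (ℝ × ℝ))
      = {(1/8, √3 * (1/16)), (7/8, √3 * (1/16)), (5/16, √3 * (9/32)), (11/16, √3 * (9/32)),
        (1/2, √3 * (15/32)), (1/2, √3 * (25/64))} := by
  have h1 : aw [0] = (1/8, √3 * (1/16)) := by
    ext <;> simp [aw, Sw, Smap] <;> ring
  have h2 : aw [1] = (7/8, √3 * (1/16)) := by
    ext <;> simp [aw, Sw, Smap] <;> ring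
  have h31 : aw [2, 0] = (5/16, √3 * (9/32)) := by
    ext <;> simp [aw, Sw, Smap] <;> ring
  have h32 : aw [2, 1] = (11/16, √3 * (9/32)) := by
    ext <;> simp [aw, Sw, Smap] <;> ring
  have h333 : aw [2, 2, 2] = (1/2, √3 * (15/32)) := by
    ext <;> simp [aw, Sw, Smap] <;> ring
  have h3312 : a12 [2, 2] = (1/2, √3 * (25/64)) := by
    ext <;> simp [a12, aw, Sw, Smap] <;> ring
  rw [h1, h2, h31, h32, h333, h3312]

/-- `α₆ = {a(1), a(2), a(31), a(32), a(333), a(331,332)}` is an optimal set of six-means,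
and `V₆(P) = 3537/563200`. -/
theorem stmt_18 (P : Measure (ℝ × ℝ)) [IsProbabilityMeasure P] (hP : IsRMeasure P) :
    IsOptimalSet P 6
        ({aw [0], aw [1], aw [2, 0], aw [2, 1], aw [2, 2, 2], a12 [2, 2]} : Set (ℝ × ℝ)) ∧
    quantErr P 6 = 3537/563200 := by
  rw [six_means_eq]
  set α : Set (ℝ × ℝ) := {(1/8, √3 * (1/16)), (7/8, √3 * (1/16)), (5/16, √3 * (9/32)),
    (11/16, √3 * (9/32)), (1/2, √3 * (15/32)), (1/2, √3 * (25/64))} with hα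
  have hne : α.Nonempty := insert_nonempty _ _
  have hf : α.Finite := toFinite _
  have hcard : α.encard ≤ (6 : ℕ) := by
    classical
    have h := Finset.card_le_six (a := ((1/8 : ℝ), √3 * (1/16))) (b := (7/8, √3 * (1/16)))
      (c := (5/16, √3 * (9/32))) (d := (11/16, √3 * (9/32))) (e := (1/2, √3 * (15/32)))
      (f := (1/2, √3 * (25/64)))
    rw [← Nat.cast_le (α := ℕ∞), ← encard_coe_eq_coe_finsetCard] at h
    simpa [hα] using h
  have hdist : distortion P α = 3537/563200 :=
    le_antisymm (hP.distortion_le_of_six_means hf (by simp [hα]) (by simp [hα]) (by simp [hα])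
      (by simp [hα]) (by simp [hα]) (by simp [hα])) (hP.le_distortion_of_card_le_six hne hcard)
  have hleast : IsLeast {v | ∃ β : Set (ℝ × ℝ), 1 ≤ β.encard ∧ β.encard ≤ ((6 : ℕ) : ℕ∞) ∧
      v = distortion P β} (3537/563200) := by
    refine ⟨⟨α, one_le_encard_iff_nonempty.mpr hne, hcard, hdist.symm⟩, ?_⟩
    rintro _ ⟨β, h1, h6, rfl⟩
    exact hP.le_distortion_of_card_le_six (one_le_encard_iff_nonempty.mp h1) h6
  have hquant : quantErr P 6 = 3537/563200 := hleast.csInf_eq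
  exact ⟨⟨one_le_encard_iff_nonempty.mpr hne, hcard, hdist.trans hquant.symm⟩, hquant⟩
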